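/- arXiv:2204.09642 — 2 statements merged into one kernel-verified Lean document; each statement's English description precedes it below -/
import Mathlib

section
/- Let W ∈ L¹₊[0,1]² be a nonnegative kernel such that the map [0,1] ∋ u ↦ W(u,v)dv ∈ M₊([0,1]) is weakly continuous, and let ξⁿ be n×n matrices with nonnegative entries and zero diagonal such that the step kernels W_{ξⁿ} converge to W in the strong operator topology. Let g : [0,1] → ℝ be continuous. Then lim_{n→∞} sup_{(u₁,…,uₙ) ∈ Iⁿ₁×⋯×Iⁿₙ} (1/n) Σ_{i=1}^n | (1/n) Σ_{j=1}^n ξⁿ_{ij} g(uⱼ) − ∫₀¹ W(uᵢ, v) g(v) dv | = 0. -/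
open MeasureTheory ProbabilityTheory Filter Set
open scoped NNReal ENNReal Topology

noncomputable section

/-- The uniform (Lebesgue) measure on `[0,1]`, as a measure on `ℝ`. -/
def unif01 : Measure ℝ := volume.restrict (Set.Icc 0 1)

/-- `Iseg n i` is the interval `Iⁿ_{i+1} = [i/n, (i+1)/n)` (`0`-indexed); the last one is
`[(n-1)/n, 1]`. -/
def Iseg (n i : ℕ) : Set ℝ :=
  if i + 1 = n then Set.Icc ((i : ℝ) / n) 1 else Set.Ico ((i : ℝ) / n) (((i : ℝ) + 1) / n)

/-- The index `i` such that `u ∈ Iseg n i`, for `u ∈ [0,1]`. -/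
def idx (n : ℕ) (u : ℝ) : ℕ := min (n - 1) ⌊(n : ℝ) * u⌋₊

/-- The step kernel `W_ξ` associated with an `n × n` matrix `ξ` with nonnegative entries. -/
def Wstep (n : ℕ) (ξ : ℕ → ℕ → ℝ≥0) : ℝ → ℝ → ℝ := fun u v => (ξ (idx n u) (idx n v) : ℝ)

/-- Convergence of kernels in the strong operator topology, for operators `L^∞[0,1] → L¹[0,1]`:
`∫₀¹ |∫₀¹ (Wₙ(u,v) − W(u,v)) ψ(v) dv| du → 0` for every bounded measurable `ψ`. -/
def StrongOpTendsto (Wn : ℕ → ℝ → ℝ → ℝ) (W : ℝ → ℝ → ℝ) : Prop :=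
  ∀ ψ : ℝ → ℝ, Measurable ψ → (∃ C, ∀ v, |ψ v| ≤ C) →
    Tendsto (fun n => ∫ u, |∫ v, (Wn n u v - W u v) * ψ v ∂unif01| ∂unif01) atTop (𝓝 0)

lemma measurable_idx (n : ℕ) : Measurable (idx n) :=
  measurable_const.min (Nat.measurable_floor.comp (measurable_const.mul measurable_id))

lemma idx_lt {n : ℕ} (hn : 0 < n) (x : ℝ) : idx n x < n := by
  unfold idx
  omega

lemma idx_eq_of_mem_Ico {n i : ℕ} (hi : i < n) {x : ℝ}
    (hx : x ∈ Set.Ico ((i : ℝ) / n) (((i : ℝ) + 1) / n)) : idx n x = i := by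
  have hn : (0 : ℝ) < n := by exact_mod_cast Nat.zero_lt_of_lt hi
  have h1 : (i : ℝ) ≤ n * x := by
    have := (div_le_iff₀ hn).1 hx.1
    linarith
  have h2 : (n : ℝ) * x < i + 1 := by
    have := (lt_div_iff₀ hn).1 hx.2
    linarith
  have h3 : ⌊(n : ℝ) * x⌋₊ = i :=
    (Nat.floor_eq_iff ((Nat.cast_nonneg i).trans h1)).2 ⟨h1, h2⟩
  unfold idx
  omega

lemma Iseg_subset {n i : ℕ} : Iseg n i ⊆ Set.Icc ((i : ℝ) / n) (((i : ℝ) + 1) / n) := by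
  intro x hx
  unfold Iseg at hx
  split_ifs at hx with h
  · have hn : (n : ℝ) = i + 1 := by exact_mod_cast h.symm
    refine ⟨hx.1, ?_⟩
    rw [hn, div_self (by positivity)]
    exact hx.2
  · exact ⟨hx.1, hx.2.le⟩

lemma Iseg_subset_Icc {n i : ℕ} (hi : i < n) : Iseg n i ⊆ Set.Icc (0 : ℝ) 1 := by
  intro x hx
  have hn : (0 : ℝ) < n := by exact_mod_cast Nat.zero_lt_of_lt hi
  have h := Iseg_subset hx
  refine ⟨le_trans (by positivity) h.1, h.2.trans ?_⟩
  rw [div_le_one hn]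
  exact_mod_cast hi

lemma mem_Icc_idx {n : ℕ} (hn : 0 < n) {x : ℝ} (hx : x ∈ Set.Icc (0 : ℝ) 1) :
    x ∈ Set.Icc ((idx n x : ℝ) / n) (((idx n x : ℝ) + 1) / n) := by
  have hn' : (0 : ℝ) < n := by exact_mod_cast hn
  have h0 : 0 ≤ (n : ℝ) * x := mul_nonneg hn'.le hx.1
  constructor
  · rw [div_le_iff₀ hn']
    have h1 : (idx n x : ℝ) ≤ ⌊(n : ℝ) * x⌋₊ := by exact_mod_cast min_le_right _ _
    linarith [Nat.floor_le h0]
  · rw [le_div_iff₀ hn']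
    have h1 : (n : ℝ) * x < ⌊(n : ℝ) * x⌋₊ + 1 := Nat.lt_floor_add_one _
    rcases le_total (n - 1) ⌊(n : ℝ) * x⌋₊ with h | h
    · have h2 : idx n x + 1 = n := by
        rw [idx, min_eq_left h]
        omega
      have h3 : (idx n x : ℝ) + 1 = n := by exact_mod_cast h2
      rw [h3]
      nlinarith [hx.2]
    · rw [idx, min_eq_right h]
      linarith

lemma abs_sub_le_of_mem_Iseg_idx {n : ℕ} (hn : 0 < n) {x y : ℝ} (hx : x ∈ Set.Icc (0 : ℝ) 1)
    (hy : y ∈ Iseg n (idx n x)) : |y - x| ≤ 1 / n := by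
  have h1 := mem_Icc_idx hn hx
  have h2 := Iseg_subset hy
  have h3 : ((idx n x : ℝ) + 1) / n = (idx n x : ℝ) / n + 1 / n := add_div _ _ _
  rw [abs_le]
  constructor <;> linarith [h1.1, h1.2, h2.1, h2.2]

instance : IsProbabilityMeasure unif01 := ⟨by simp [unif01]⟩

lemma ae_unif01_mem_Icc : ∀ᵐ x ∂unif01, x ∈ Set.Icc (0 : ℝ) 1 :=
  ae_restrict_mem measurableSet_Icc

lemma integrable_comp_idx {n : ℕ} (hn : 0 < n) (F : ℕ → ℝ) :
    Integrable (fun x => F (idx n x)) unif01 := by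
  refine Integrable.of_bound (C := ∑ i ∈ Finset.range n, |F i|)
    ((measurable_from_nat (f := F)).comp (measurable_idx n)).aestronglyMeasurable
    (ae_of_all _ fun x => ?_)
  exact Finset.single_le_sum (f := fun i => |F i|) (fun i _ => abs_nonneg _)
    (Finset.mem_range.2 (idx_lt hn x))

lemma integral_comp_idx {n : ℕ} (hn : 0 < n) (F : ℕ → ℝ) :
    ∫ x, F (idx n x) ∂unif01 = (1 / (n : ℝ)) * ∑ i ∈ Finset.range n, F i := by
  have hn' : (0 : ℝ) < n := by exact_mod_cast hn
  have hint : IntegrableOn (fun x => F (idx n x)) (Set.Icc 0 1) volume :=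
    integrable_comp_idx hn F
  have hle : ∀ k : ℕ, (k : ℝ) / n ≤ ((k + 1 : ℕ) : ℝ) / n := fun k => by
    gcongr
    exact Nat.le_succ k
  have hsum := intervalIntegral.sum_integral_adjacent_intervals (μ := volume)
    (f := fun x => F (idx n x)) (a := fun k : ℕ => (k : ℝ) / n) (n := n) (by
      intro k hk
      rw [intervalIntegrable_iff_integrableOn_Icc_of_le (hle k)]
      refine hint.mono_set (Set.Icc_subset_Icc (by positivity) ?_)
      rw [div_le_one hn']
      exact_mod_cast hk)
  have hterm : ∀ k ∈ Finset.range n,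
      ∫ x in ((k : ℝ) / n)..(((k + 1 : ℕ) : ℝ) / n), F (idx n x) = (1 / (n : ℝ)) * F k := by
    intro k hk
    rw [intervalIntegral.integral_of_le (hle k), integral_Ioc_eq_integral_Ioo,
      ← integral_Ico_eq_integral_Ioo,
      setIntegral_congr_fun (g := fun _ => F k) measurableSet_Ico (fun x hx => ?_)]
    · rw [setIntegral_const, Measure.real, Real.volume_Ico, ENNReal.toReal_ofReal
        (sub_nonneg.2 (hle k)), smul_eq_mul]
      push_cast
      ring
    · have hx' : x ∈ Set.Ico ((k : ℝ) / n) (((k : ℝ) + 1) / n) := by simpa using hx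
      simp only [idx_eq_of_mem_Ico (Finset.mem_range.1 hk) hx']
  rw [Finset.sum_congr rfl hterm, ← Finset.mul_sum] at hsum
  rw [hsum, unif01, integral_Icc_eq_integral_Ioc, Nat.cast_zero, zero_div, div_self hn'.ne',
    intervalIntegral.integral_of_le zero_le_one]

lemma integrable_unif01_of_continuousOn {f : ℝ → ℝ} (hf : ContinuousOn f (Set.Icc 0 1)) :
    Integrable f unif01 :=
  hf.integrableOn_Icc

/-- On the unit interval a continuous function is uniformly approximated by its values at
sample points, one from each segment of the partition. -/
lemma eventually_abs_sub_le_of_mem_Iseg_idx {f : ℝ → ℝ} (hf : ContinuousOn f (Set.Icc 0 1))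
    {δ : ℝ} (hδ : 0 < δ) :
    ∀ᶠ n : ℕ in atTop, ∀ x ∈ Set.Icc (0 : ℝ) 1, ∀ y ∈ Iseg n (idx n x), |f y - f x| ≤ δ := by
  obtain ⟨η, hη, h⟩ := Metric.uniformContinuousOn_iff.1
    (isCompact_Icc.uniformContinuousOn_of_continuous hf) δ hδ
  have hlim : Tendsto (fun n : ℕ => 1 / (n : ℝ)) atTop (𝓝 0) :=
    tendsto_const_div_atTop_nhds_zero_nat 1
  filter_upwards [hlim.eventually_lt_const hη, eventually_gt_atTop 0] with n hn hpos x hx y hy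
  have hd := h y (Iseg_subset_Icc (idx_lt hpos x) hy) x hx
    ((abs_sub_le_of_mem_Iseg_idx hpos hx hy).trans_lt hn)
  exact hd.le

lemma integrable_Wstep_mul {n : ℕ} (hn : 0 < n) (ξ : ℕ → ℕ → ℝ≥0) {g : ℝ → ℝ}
    (hg : Integrable g unif01) (x : ℝ) : Integrable (fun v => Wstep n ξ x v * g v) unif01 := by
  refine hg.bdd_mul (c := ∑ j ∈ Finset.range n, (ξ (idx n x) j : ℝ))
    (integrable_comp_idx hn fun j => (ξ (idx n x) j : ℝ)).aestronglyMeasurable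
    (ae_of_all _ fun v => ?_)
  rw [Wstep, Real.norm_of_nonneg (NNReal.coe_nonneg _)]
  exact Finset.single_le_sum (f := fun j => (ξ (idx n x) j : ℝ)) (fun i _ => NNReal.coe_nonneg _)
    (Finset.mem_range.2 (idx_lt hn v))

/-- The integral of a step kernel against `g` differs from its sampled version by at most the
sampling error times the row integral. -/
lemma abs_sum_sub_integral_Wstep_le {n : ℕ} (hn : 0 < n) (ξ : ℕ → ℕ → ℝ≥0) {g : ℝ → ℝ}
    (hg : Integrable g unif01) {y : ℕ → ℝ} {δ : ℝ}
    (hδ : ∀ v ∈ Set.Icc (0 : ℝ) 1, |g (y (idx n v)) - g v| ≤ δ) (x : ℝ) :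
    |(1 / (n : ℝ)) * (∑ j ∈ Finset.range n, (ξ (idx n x) j : ℝ) * g (y j))
        - ∫ v, Wstep n ξ x v * g v ∂unif01| ≤ δ * ∫ v, Wstep n ξ x v ∂unif01 := by
  have hrow : Integrable (fun v => Wstep n ξ x v) unif01 :=
    integrable_comp_idx hn fun j => (ξ (idx n x) j : ℝ)
  rw [← integral_comp_idx hn fun j => (ξ (idx n x) j : ℝ) * g (y j),
    ← integral_sub (integrable_comp_idx hn fun j => (ξ (idx n x) j : ℝ) * g (y j))
      (integrable_Wstep_mul hn ξ hg x), ← integral_const_mul]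
  rw [← Real.norm_eq_abs]
  refine norm_integral_le_of_norm_le (hrow.const_mul δ) ?_
  filter_upwards [ae_unif01_mem_Icc] with v hv
  have h0 : 0 ≤ Wstep n ξ x v := NNReal.coe_nonneg _
  have h1 : (ξ (idx n x) (idx n v) : ℝ) * g (y (idx n v)) - Wstep n ξ x v * g v
      = Wstep n ξ x v * (g (y (idx n v)) - g v) := by
    rw [Wstep]
    ring
  rw [h1, Real.norm_eq_abs, abs_mul, abs_of_nonneg h0, mul_comm δ]
  exact mul_le_mul_of_nonneg_left (hδ v hv) h0

lemma integral_Wstep_sub_mul {n : ℕ} (hn : 0 < n) (ξ : ℕ → ℕ → ℝ≥0) {W : ℝ → ℝ → ℝ} {g : ℝ → ℝ}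
    (hg : Integrable g unif01) {x : ℝ} (hW : Integrable (fun v => W x v * g v) unif01) :
    ∫ v, (Wstep n ξ x v - W x v) * g v ∂unif01
      = ∫ v, Wstep n ξ x v * g v ∂unif01 - ∫ v, W x v * g v ∂unif01 := by
  simp_rw [sub_mul]
  exact integral_sub (integrable_Wstep_mul hn ξ hg x) hW

/-- The integral in the definition of `StrongOpTendsto` is that of an integrable function when
one of the kernels is a step kernel and the other acts continuously on the test function. -/
lemma integrable_abs_integral_Wstep_sub_mul {n : ℕ} (hn : 0 < n) (ξ : ℕ → ℕ → ℝ≥0)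
    {W : ℝ → ℝ → ℝ} {g : ℝ → ℝ} (hg : Integrable g unif01)
    (hW : ∀ x ∈ Set.Icc (0 : ℝ) 1, Integrable (fun v => W x v * g v) unif01)
    (hcont : ContinuousOn (fun x => ∫ v, W x v * g v ∂unif01) (Set.Icc 0 1)) :
    Integrable (fun x => |∫ v, (Wstep n ξ x v - W x v) * g v ∂unif01|) unif01 := by
  refine Integrable.abs (((integrable_comp_idx hn
    fun i => ∫ v, (ξ i (idx n v) : ℝ) * g v ∂unif01).sub
      (integrable_unif01_of_continuousOn hcont)).congr ?_)
  filter_upwards [ae_unif01_mem_Icc] with x hx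
  rw [integral_Wstep_sub_mul hn ξ hg (hW x hx)]
  rfl

/-- The approximation for globally continuous bounded `g`, with sample points indexed by `ℕ`. -/
lemma eventually_mean_abs_sum_sub_integral_lt {W : ℝ → ℝ → ℝ}
    (hWslice : ∀ u ∈ Set.Icc (0 : ℝ) 1, Integrable (W u) unif01)
    (hWcont : ∀ g : ℝ → ℝ, Continuous g →
      ContinuousOn (fun u => ∫ v, W u v * g v ∂unif01) (Set.Icc (0 : ℝ) 1))
    {ξ : ℕ → ℕ → ℕ → ℝ≥0} (hconv : StrongOpTendsto (fun n => Wstep n (ξ n)) W)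
    {g : ℝ → ℝ} (hg : Continuous g) (hgb : ∃ C, ∀ v, |g v| ≤ C) {ε : ℝ} (hε : 0 < ε) :
    ∀ᶠ n : ℕ in atTop, ∀ u : ℕ → ℝ, (∀ i < n, u i ∈ Iseg n i) →
      (1 / (n : ℝ)) * ∑ i ∈ Finset.range n,
          |(1 / (n : ℝ)) * (∑ j ∈ Finset.range n, (ξ n i j : ℝ) * g (u j))
            - ∫ v, W (u i) v * g v ∂unif01| < ε := by
  have hgi : Integrable g unif01 := integrable_unif01_of_continuousOn hg.continuousOn
  have h1i : Integrable (fun _ : ℝ => (1 : ℝ)) unif01 := integrable_const 1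
  have hG := hWcont g hg
  have hH := hWcont (fun _ => 1) continuous_const
  have hWg : ∀ x ∈ Set.Icc (0 : ℝ) 1, Integrable (fun v => W x v * g v) unif01 := by
    obtain ⟨C, hC⟩ := hgb
    exact fun x hx => (hWslice x hx).mul_bdd (c := C) hg.aestronglyMeasurable (ae_of_all _ hC)
  have hW1 : ∀ x ∈ Set.Icc (0 : ℝ) 1, Integrable (fun v => W x v * 1) unif01 := by
    simpa only [mul_one] using hWslice
  obtain ⟨M, hM⟩ := isCompact_Icc.exists_bound_of_continuousOn hH
  have hM0 : 0 ≤ M := (norm_nonneg _).trans (hM 0 (by simp))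
  have hA := hconv g hg.measurable hgb
  have hB := hconv (fun _ => 1) measurable_const ⟨1, by simp⟩
  set δ : ℝ := ε / (2 * (M + 3)) with hδdef
  have hδ : 0 < δ := by positivity
  have hδε : δ * (M + 3) < ε := by
    have : δ * (M + 3) = ε / 2 := by
      rw [hδdef]
      field_simp
    linarith
  filter_upwards [hA.eventually_lt_const hδ, hB.eventually_lt_const one_pos,
    eventually_abs_sub_le_of_mem_Iseg_idx hg.continuousOn hδ,
    eventually_abs_sub_le_of_mem_Iseg_idx hG hδ, eventually_gt_atTop 0]
    with n hAn hBn hgn hGn hn u hu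
  have hAi := integrable_abs_integral_Wstep_sub_mul hn (ξ n) hgi hWg hG
  have hBi := integrable_abs_integral_Wstep_sub_mul hn (ξ n) h1i hW1 hH
  rw [← integral_comp_idx hn fun i => |(1 / (n : ℝ)) * (∑ j ∈ Finset.range n,
    (ξ n i j : ℝ) * g (u j)) - ∫ v, W (u i) v * g v ∂unif01|]
  have hbound : ∀ x ∈ Set.Icc (0 : ℝ) 1, |(1 / (n : ℝ)) * (∑ j ∈ Finset.range n,
      (ξ n (idx n x) j : ℝ) * g (u j)) - ∫ v, W (u (idx n x)) v * g v ∂unif01|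
      ≤ δ * (|∫ v, (Wstep n (ξ n) x v - W x v) * 1 ∂unif01| + M)
        + |∫ v, (Wstep n (ξ n) x v - W x v) * g v ∂unif01| + δ := by
    intro x hx
    have h1 := abs_sum_sub_integral_Wstep_le hn (ξ n) hgi (y := u)
      (fun v hv => hgn v hv _ (hu _ (idx_lt hn v))) x
    have h2 := hGn x hx _ (hu _ (idx_lt hn x))
    have h3 : ∫ v, Wstep n (ξ n) x v ∂unif01
        ≤ |∫ v, (Wstep n (ξ n) x v - W x v) * 1 ∂unif01| + M := by
      have h4 := integral_Wstep_sub_mul hn (ξ n) h1i (hW1 x hx)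
      have h5 := (le_abs_self _).trans (hM x hx)
      have h6 := le_abs_self (∫ v, (Wstep n (ξ n) x v - W x v) * 1 ∂unif01)
      simp only [mul_one] at h4 h5 h6 ⊢
      linarith
    have h7 := mul_le_mul_of_nonneg_left h3 hδ.le
    rw [integral_Wstep_sub_mul hn (ξ n) hgi (hWg x hx)]
    rw [abs_sub_comm] at h2
    have h8 := abs_sub_le ((1 / (n : ℝ)) * (∑ j ∈ Finset.range n,
      (ξ n (idx n x) j : ℝ) * g (u j))) (∫ v, Wstep n (ξ n) x v * g v ∂unif01)
      (∫ v, W (u (idx n x)) v * g v ∂unif01)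
    have h9 := abs_sub_le (∫ v, Wstep n (ξ n) x v * g v ∂unif01)
      (∫ v, W x v * g v ∂unif01) (∫ v, W (u (idx n x)) v * g v ∂unif01)
    linarith
  have hBM := (hBi.fun_add (integrable_const M)).const_mul δ
  refine (integral_mono_ae (integrable_comp_idx hn fun i => |(1 / (n : ℝ)) *
      (∑ j ∈ Finset.range n, (ξ n i j : ℝ) * g (u j)) - ∫ v, W (u i) v * g v ∂unif01|)
    ((hBM.fun_add hAi).fun_add (integrable_const δ))
    (ae_unif01_mem_Icc.mono hbound)).trans_lt ?_
  rw [integral_add (hBM.fun_add hAi) (integrable_const δ), integral_add hBM hAi, integral_const_mul,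
    integral_add hBi (integrable_const M)]
  simp only [integral_const, probReal_univ, one_smul]
  nlinarith [mul_lt_mul_of_pos_left hBn hδ]

/-- deterministic approximation along labels.  Let `W ∈ L¹₊[0,1]²` be a
nonnegative kernel with `u ↦ W(u,v)dv ∈ M₊([0,1])` weakly continuous, and let `ξⁿ` be matrices
with nonnegative entries and zero diagonal whose step kernels converge to `W` in the strong
operator topology.  Then for every continuous `g : [0,1] → ℝ`,
`sup_{u ∈ Iⁿ₁×⋯×Iⁿₙ} (1/n) Σᵢ |(1/n) Σⱼ ξⁿᵢⱼ g(uⱼ) − ∫₀¹ W(uᵢ,v) g(v) dv| → 0`. -/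
theorem step_kernel_sums_approximate_kernel_integrals
    (W : ℝ → ℝ → ℝ)
    (hWmeas : Measurable fun p : ℝ × ℝ => W p.1 p.2)
    (hWint : Integrable (fun p : ℝ × ℝ => W p.1 p.2) (unif01.prod unif01))
    (hWnonneg : ∀ᵐ p ∂unif01.prod unif01, 0 ≤ W p.1 p.2)
    (hWslice : ∀ u ∈ Set.Icc (0:ℝ) 1, Integrable (W u) unif01)
    (hWcont : ∀ g : ℝ → ℝ, Continuous g →
      ContinuousOn (fun u => ∫ v, W u v * g v ∂unif01) (Set.Icc (0:ℝ) 1))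
    (ξ : ℕ → ℕ → ℕ → ℝ≥0) (hξdiag : ∀ n i, ξ n i i = 0)
    (hconv : StrongOpTendsto (fun n => Wstep n (ξ n)) W)
    (g : ℝ → ℝ) (hg : ContinuousOn g (Set.Icc (0:ℝ) 1)) :
    ∀ ε > (0:ℝ), ∃ N : ℕ, ∀ n ≥ N, ∀ u : Fin n → ℝ, (∀ i : Fin n, u i ∈ Iseg n i) →
      (1 / (n : ℝ)) * ∑ i : Fin n,
          |(1 / (n : ℝ)) * (∑ j : Fin n, (ξ n i j : ℝ) * g (u j))
            - ∫ v, W (u i) v * g v ∂unif01|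
        < ε := by
  set g' : ℝ → ℝ := Set.IccExtend zero_le_one (Set.domRestrict (Set.Icc 0 1) g) with hg'def
  have hg' : Continuous g' := (continuousOn_iff_continuous_domRestrict.1 hg).Icc_extend'
  have heq : ∀ v ∈ Set.Icc (0 : ℝ) 1, g' v = g v := fun v hv =>
    Set.IccExtend_of_mem zero_le_one _ hv
  have hgb : ∃ C, ∀ v, |g' v| ≤ C := by
    obtain ⟨C, hC⟩ := isCompact_Icc.exists_bound_of_continuousOn hg
    exact ⟨C, fun v => hC _ (Set.projIcc 0 1 zero_le_one v).2⟩
  have hint : ∀ x, ∫ v, W x v * g v ∂unif01 = ∫ v, W x v * g' v ∂unif01 := fun x =>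
    integral_congr_ae (ae_unif01_mem_Icc.mono fun v hv => by simp only [heq v hv])
  intro ε hε
  obtain ⟨N, hN⟩ := eventually_atTop.1
    (eventually_mean_abs_sum_sub_integral_lt hWslice hWcont hconv hg' hgb hε)
  refine ⟨N, fun n hn u hu => ?_⟩
  have h := hN n hn (fun i => if hi : i < n then u ⟨i, hi⟩ else 0) fun i hi => by
    simpa only [dif_pos hi] using hu ⟨i, hi⟩
  simp only [Finset.sum_range, Fin.is_lt, dite_true, Fin.eta] at h
  simp only [hint]
  simpa only [heq _ (Iseg_subset_Icc (Fin.is_lt _) (hu _))] using h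

end
end

section
/- Let W ∈ L¹₊[0,1]² be a nonnegative kernel that is positive semidefinite as an integral operator, meaning ∫₀¹∫₀¹ W(u,v) ρ(u) ρ(v) du dv ≥ 0 for every bounded measurable ρ : [0,1] → ℝ. Let φ : ℝ^d → ℝ be bounded and continuous, and define g : ℝ^d × M₊(ℝ^d) → ℝ by g(x, m) = (φ(x) − ∫_{ℝ^d} φ dm)². Then for all m₁, m₂ ∈ P_Unif([0,1] × ℝ^d), ∫_{[0,1]×ℝ^d} ( g(x, Wm₁(u)) − g(x, Wm₂(u)) ) (m₁ − m₂)(du, dx) ≤ 0; indeed, this quantity equals a negative constant multiple of ∫₀¹∫₀¹ W(u,v) ψ(u) ψ(v) du dv, where ψ(u) = ∫_{ℝ^d} φ(x) (m¹_u − m²_u)(dx) and u ↦ mⁱ_u is the disintegration of mᵢ. -/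
open MeasureTheory ProbabilityTheory Filter Set
open scoped NNReal ENNReal Topology

noncomputable section

/-- The measure `Wm(u)` on `E` associated with a kernel `W` and a measure `m` on `[0,1] × E`:
it integrates a function `φ` to `∫_{[0,1]×E} W(u,v) φ(x) m(dv,dx)`. -/
def Wmeas {E : Type*} [MeasurableSpace E] (W : ℝ → ℝ → ℝ) (m : Measure (ℝ × E)) (u : ℝ) :
    Measure E :=
  (m.withDensity fun p => ENNReal.ofReal (W u p.1)).map Prod.snd

section Disintegration

variable {E : Type*} [MeasurableSpace E]

lemma bind_map_prodMk_eq_compProd {μ : Measure ℝ} [SFinite μ] (κ : Kernel ℝ E)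
    [IsMarkovKernel κ] : (μ.bind fun u => (κ u).map fun x => (u, x)) = μ ⊗ₘ κ := by
  have hmeas : Measurable fun u => (κ u).map fun x => (u, x) := by
    refine Measure.measurable_of_measurable_coe _ fun s hs => ?_
    simp_rw [Measure.map_apply measurable_prodMk_left hs]
    exact Kernel.measurable_kernel_prodMk_left hs
  ext s hs
  rw [Measure.bind_apply hs hmeas.aemeasurable, Measure.compProd_apply hs]
  simp_rw [Measure.map_apply measurable_prodMk_left hs]

lemma abs_integral_le_of_abs_le {ν : Measure E} [IsProbabilityMeasure ν] {φ : E → ℝ} {C : ℝ}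
    (hC : ∀ x, |φ x| ≤ C) : |∫ y, φ y ∂ν| ≤ C := by
  simpa using norm_integral_le_of_norm_le_const (μ := ν) (f := φ) (Eventually.of_forall hC)

lemma integrable_fst_mul_bdd_snd_compProd {μ : Measure ℝ} [SFinite μ] (κ : Kernel ℝ E)
    [IsMarkovKernel κ] {φ : E → ℝ} (hφ : Measurable φ) {C : ℝ} (hC : ∀ x, |φ x| ≤ C)
    {b : ℝ → ℝ} (hb : Integrable b μ) :
    Integrable (fun p : ℝ × E => b p.1 * φ p.2) (μ ⊗ₘ κ) := by
  have hbfst : Integrable (fun p : ℝ × E => b p.1) (μ ⊗ₘ κ) := by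
    have h : (μ ⊗ₘ κ).map Prod.fst = μ := Measure.fst_compProd μ κ
    rw [← h] at hb
    exact hb.comp_measurable measurable_fst
  exact hbfst.mul_bdd (hφ.comp measurable_snd).aestronglyMeasurable
    (Eventually.of_forall fun p => hC p.2)

lemma integral_fst_mul_snd_compProd {μ : Measure ℝ} [SFinite μ] (κ : Kernel ℝ E)
    [IsMarkovKernel κ] {φ : E → ℝ} (hφ : Measurable φ) {C : ℝ} (hC : ∀ x, |φ x| ≤ C)
    {b : ℝ → ℝ} (hb : Integrable b μ) :
    ∫ p : ℝ × E, b p.1 * φ p.2 ∂(μ ⊗ₘ κ) = ∫ u, b u * ∫ y, φ y ∂(κ u) ∂μ := by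
  rw [Measure.integral_compProd (integrable_fst_mul_bdd_snd_compProd κ hφ hC hb)]
  simp_rw [integral_const_mul]

lemma integral_Wmeas_compProd {μ : Measure ℝ} [SFinite μ] (κ : Kernel ℝ E)
    [IsMarkovKernel κ] {φ : E → ℝ} (hφ : Measurable φ) {C : ℝ} (hC : ∀ x, |φ x| ≤ C)
    {W : ℝ → ℝ → ℝ} (hW : Measurable fun p : ℝ × ℝ => W p.1 p.2)
    (hWint : Integrable (fun p : ℝ × ℝ => W p.1 p.2) (μ.prod μ))
    (hW0 : ∀ᵐ p ∂μ.prod μ, 0 ≤ W p.1 p.2) :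
    ∀ᵐ u ∂μ, ∫ y, φ y ∂(Wmeas W (μ ⊗ₘ κ) u) = ∫ v, W u v * ∫ y, φ y ∂(κ v) ∂μ := by
  filter_upwards [hWint.prod_right_ae, Measure.ae_ae_of_ae_prod hW0] with u hu hu0
  have hWu : Measurable fun v => W u v := hW.comp measurable_prodMk_left
  have hWfst : ∀ᵐ p ∂(μ ⊗ₘ κ), 0 ≤ W u p.1 := by
    have h : (μ ⊗ₘ κ).map Prod.fst = μ := Measure.fst_compProd μ κ
    rw [← h] at hu0
    exact ae_of_ae_map measurable_fst.aemeasurable hu0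
  rw [Wmeas, integral_map measurable_snd.aemeasurable hφ.aestronglyMeasurable,
    integral_withDensity_eq_integral_toReal_smul (by fun_prop) (by simp),
    ← integral_fst_mul_snd_compProd κ hφ hC hu]
  refine integral_congr_ae ?_
  filter_upwards [hWfst] with p hp
  simp [ENNReal.toReal_ofReal hp]

lemma integrable_Wmeas_compProd {μ : Measure ℝ} [SFinite μ] (κ : Kernel ℝ E)
    [IsMarkovKernel κ] {φ : E → ℝ} (hφ : Measurable φ) {C : ℝ} (hC : ∀ x, |φ x| ≤ C)
    {W : ℝ → ℝ → ℝ} (hW : Measurable fun p : ℝ × ℝ => W p.1 p.2)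
    (hWint : Integrable (fun p : ℝ × ℝ => W p.1 p.2) (μ.prod μ))
    (hW0 : ∀ᵐ p ∂μ.prod μ, 0 ≤ W p.1 p.2) :
    Integrable (fun u => ∫ y, φ y ∂(Wmeas W (μ ⊗ₘ κ) u)) μ := by
  have hψ : Measurable fun v => ∫ y, φ y ∂(κ v) :=
    (hφ.stronglyMeasurable.integral_kernel (κ := κ)).measurable
  have h : Integrable (fun p : ℝ × ℝ => W p.1 p.2 * ∫ y, φ y ∂(κ p.2)) (μ.prod μ) :=
    hWint.mul_bdd (hψ.comp measurable_snd).aestronglyMeasurable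
      (Eventually.of_forall fun p => abs_integral_le_of_abs_le hC)
  refine h.integral_prod_left.congr ?_
  filter_upwards [integral_Wmeas_compProd κ hφ hC hW hWint hW0] with u hu using hu.symm

lemma integral_fst_add_mul_snd_compProd_sub {μ : Measure ℝ} [SFinite μ] (κ₁ κ₂ : Kernel ℝ E)
    [IsMarkovKernel κ₁] [IsMarkovKernel κ₂] {φ : E → ℝ} (hφ : Measurable φ) {C : ℝ}
    (hC : ∀ x, |φ x| ≤ C) {a b : ℝ → ℝ} (hb : Integrable b μ)
    (ha : AEStronglyMeasurable a μ)
    (hF : Integrable (fun p : ℝ × E => a p.1 + b p.1 * φ p.2) (μ ⊗ₘ κ₁)) :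
    (∫ p : ℝ × E, (a p.1 + b p.1 * φ p.2) ∂(μ ⊗ₘ κ₁))
      - ∫ p : ℝ × E, (a p.1 + b p.1 * φ p.2) ∂(μ ⊗ₘ κ₂)
    = ∫ u, b u * ((∫ y, φ y ∂(κ₁ u)) - ∫ y, φ y ∂(κ₂ u)) ∂μ := by
  have h₁ : (μ ⊗ₘ κ₁).map Prod.fst = μ := Measure.fst_compProd μ κ₁
  have h₂ : (μ ⊗ₘ κ₂).map Prod.fst = μ := Measure.fst_compProd μ κ₂
  have haint : Integrable a μ := by
    have h := hF.sub (integrable_fst_mul_bdd_snd_compProd κ₁ hφ hC hb)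
    rw [← h₁]
    refine (integrable_map_measure (by rwa [h₁]) measurable_fst.aemeasurable).2
      (h.congr (Eventually.of_forall fun p => ?_))
    simp
  have key : ∀ (κ : Kernel ℝ E) [IsMarkovKernel κ],
      ∫ p : ℝ × E, (a p.1 + b p.1 * φ p.2) ∂(μ ⊗ₘ κ)
        = ∫ u, a u ∂μ + ∫ u, b u * ∫ y, φ y ∂(κ u) ∂μ := by
    intro κ _
    have hafst : Integrable (fun p : ℝ × E => a p.1 * 1) (μ ⊗ₘ κ) :=
      integrable_fst_mul_bdd_snd_compProd (φ := fun _ => 1) (C := 1) κ measurable_const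
        (by simp) haint
    have haeq := integral_fst_mul_snd_compProd (φ := fun _ => 1) (C := 1) κ measurable_const
        (by simp) haint
    simp only [mul_one, integral_const, probReal_univ, smul_eq_mul] at hafst haeq
    rw [integral_add hafst (integrable_fst_mul_bdd_snd_compProd κ hφ hC hb), haeq,
      integral_fst_mul_snd_compProd κ hφ hC hb]
  have hint : ∀ (κ : Kernel ℝ E) [IsMarkovKernel κ],
      Integrable (fun u => b u * ∫ y, φ y ∂(κ u)) μ := fun κ _ =>
    hb.mul_bdd (hφ.stronglyMeasurable.integral_kernel (κ := κ)).aestronglyMeasurable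
      (Eventually.of_forall fun u => abs_integral_le_of_abs_le hC)
  rw [key κ₁, key κ₂, add_sub_add_left_eq_sub, ← integral_sub (hint κ₁) (hint κ₂)]
  simp_rw [mul_sub]

end Disintegration

/-- monotonicity of the quadratic terminal cost.  Let `W ∈ L¹₊[0,1]²` be a
positive-semidefinite kernel, `φ : ℝ^d → ℝ` bounded continuous, and
`g(x,m) = (φ(x) − ∫ φ dm)²`.  Then for all `m₁, m₂ ∈ P_Unif([0,1] × ℝ^d)` with disintegrations
`u ↦ mⁱ_u` (assuming the integrand is integrable, so that the integral against the signed
measure `m₁ − m₂` is defined), the quantity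
`∫ (g(x, Wm₁(u)) − g(x, Wm₂(u))) (m₁−m₂)(du,dx)` is `≤ 0`; indeed it equals
`−c ∫₀¹∫₀¹ W(u,v) ψ(u) ψ(v) du dv` for a constant `c > 0`, where
`ψ(u) = ∫ φ d(m¹_u − m²_u)`. -/
theorem quadratic_cost_monotonicity
    {d : ℕ}
    (W : ℝ → ℝ → ℝ)
    (hWmeas : Measurable fun p : ℝ × ℝ => W p.1 p.2)
    (hWint : Integrable (fun p : ℝ × ℝ => W p.1 p.2) (unif01.prod unif01))
    (hWnonneg : ∀ᵐ p ∂unif01.prod unif01, 0 ≤ W p.1 p.2)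
    (hWpsd : ∀ ρ : ℝ → ℝ, Measurable ρ → (∃ C, ∀ x, |ρ x| ≤ C) →
      0 ≤ ∫ u, ∫ v, W u v * ρ u * ρ v ∂unif01 ∂unif01)
    (φ : (Fin d → ℝ) → ℝ) (hφcont : Continuous φ) (hφbdd : ∃ C, ∀ x, |φ x| ≤ C)
    (m₁ m₂ : Measure (ℝ × (Fin d → ℝ)))
    [IsProbabilityMeasure m₁] [IsProbabilityMeasure m₂]
    (h1fst : m₁.map Prod.fst = unif01) (h2fst : m₂.map Prod.fst = unif01)
    (m1d m2d : ℝ → ProbabilityMeasure (Fin d → ℝ))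
    (hm1dmeas : Measurable fun u => (m1d u : Measure (Fin d → ℝ)))
    (hm2dmeas : Measurable fun u => (m2d u : Measure (Fin d → ℝ)))
    (h1dis : m₁ = unif01.bind fun u => (m1d u : Measure (Fin d → ℝ)).map fun x => (u, x))
    (h2dis : m₂ = unif01.bind fun u => (m2d u : Measure (Fin d → ℝ)).map fun x => (u, x))
    (hFint₁ : Integrable (fun p : ℝ × (Fin d → ℝ) =>
      (φ p.2 - ∫ y, φ y ∂(Wmeas W m₁ p.1)) ^ 2
        - (φ p.2 - ∫ y, φ y ∂(Wmeas W m₂ p.1)) ^ 2) m₁)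
    (hFint₂ : Integrable (fun p : ℝ × (Fin d → ℝ) =>
      (φ p.2 - ∫ y, φ y ∂(Wmeas W m₁ p.1)) ^ 2
        - (φ p.2 - ∫ y, φ y ∂(Wmeas W m₂ p.1)) ^ 2) m₂) :
    ((∫ p, ((φ p.2 - ∫ y, φ y ∂(Wmeas W m₁ p.1)) ^ 2
          - (φ p.2 - ∫ y, φ y ∂(Wmeas W m₂ p.1)) ^ 2) ∂m₁)
      - ∫ p, ((φ p.2 - ∫ y, φ y ∂(Wmeas W m₁ p.1)) ^ 2
          - (φ p.2 - ∫ y, φ y ∂(Wmeas W m₂ p.1)) ^ 2) ∂m₂) ≤ 0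
    ∧ ∃ c : ℝ, 0 < c ∧
      ((∫ p, ((φ p.2 - ∫ y, φ y ∂(Wmeas W m₁ p.1)) ^ 2
            - (φ p.2 - ∫ y, φ y ∂(Wmeas W m₂ p.1)) ^ 2) ∂m₁)
        - ∫ p, ((φ p.2 - ∫ y, φ y ∂(Wmeas W m₁ p.1)) ^ 2
            - (φ p.2 - ∫ y, φ y ∂(Wmeas W m₂ p.1)) ^ 2) ∂m₂)
      = -c * ∫ u, ∫ v, W u v
            * ((∫ y, φ y ∂(m1d u : Measure (Fin d → ℝ)))
                - ∫ y, φ y ∂(m2d u : Measure (Fin d → ℝ)))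
            * ((∫ y, φ y ∂(m1d v : Measure (Fin d → ℝ)))
                - ∫ y, φ y ∂(m2d v : Measure (Fin d → ℝ)))
          ∂unif01 ∂unif01 := by
  obtain ⟨C, hC⟩ := hφbdd
  have hφ := hφcont.measurable
  let κ₁ : Kernel ℝ (Fin d → ℝ) := ⟨fun u => (m1d u : Measure (Fin d → ℝ)), hm1dmeas⟩
  let κ₂ : Kernel ℝ (Fin d → ℝ) := ⟨fun u => (m2d u : Measure (Fin d → ℝ)), hm2dmeas⟩
  have : IsMarkovKernel κ₁ := ⟨fun u => (m1d u).prop⟩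
  have : IsMarkovKernel κ₂ := ⟨fun u => (m2d u).prop⟩
  have e₁ : m₁ = unif01 ⊗ₘ κ₁ := h1dis.trans (bind_map_prodMk_eq_compProd κ₁)
  have e₂ : m₂ = unif01 ⊗ₘ κ₂ := h2dis.trans (bind_map_prodMk_eq_compProd κ₂)
  have hA₁ := integral_Wmeas_compProd κ₁ hφ hC hWmeas hWint hWnonneg
  have hA₂ := integral_Wmeas_compProd κ₂ hφ hC hWmeas hWint hWnonneg
  have hI₁ := integrable_Wmeas_compProd κ₁ hφ hC hWmeas hWint hWnonneg
  have hI₂ := integrable_Wmeas_compProd κ₂ hφ hC hWmeas hWint hWnonneg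
  rw [← e₁] at hA₁ hI₁
  rw [← e₂] at hA₂ hI₂
  set A₁ : ℝ → ℝ := fun u => ∫ y, φ y ∂(Wmeas W m₁ u)
  set A₂ : ℝ → ℝ := fun u => ∫ y, φ y ∂(Wmeas W m₂ u)
  set ψ₁ : ℝ → ℝ := fun u => ∫ y, φ y ∂(κ₁ u)
  set ψ₂ : ℝ → ℝ := fun u => ∫ y, φ y ∂(κ₂ u)
  have hψ₁ : Measurable ψ₁ := (hφ.stronglyMeasurable.integral_kernel (κ := κ₁)).measurable
  have hψ₂ : Measurable ψ₂ := (hφ.stronglyMeasurable.integral_kernel (κ := κ₂)).measurable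
  have hC₁ : ∀ u, |ψ₁ u| ≤ C := fun u => abs_integral_le_of_abs_le hC
  have hC₂ : ∀ u, |ψ₂ u| ≤ C := fun u => abs_integral_le_of_abs_le hC
  have hF : (fun p : ℝ × (Fin d → ℝ) => (φ p.2 - A₁ p.1) ^ 2 - (φ p.2 - A₂ p.1) ^ 2)
      = fun p => (A₁ p.1 ^ 2 - A₂ p.1 ^ 2) + (-2 * (A₁ p.1 - A₂ p.1)) * φ p.2 := by
    ext p; ring
  have hEq : (∫ p, ((φ p.2 - A₁ p.1) ^ 2 - (φ p.2 - A₂ p.1) ^ 2) ∂m₁)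
      - ∫ p, ((φ p.2 - A₁ p.1) ^ 2 - (φ p.2 - A₂ p.1) ^ 2) ∂m₂
      = -2 * ∫ u, ∫ v, W u v * (ψ₁ u - ψ₂ u) * (ψ₁ v - ψ₂ v) ∂unif01 ∂unif01 := by
    have hF₁ : Integrable (fun p : ℝ × (Fin d → ℝ) =>
        (φ p.2 - A₁ p.1) ^ 2 - (φ p.2 - A₂ p.1) ^ 2) m₁ := hFint₁
    rw [hF, e₁] at hF₁
    have h := integral_fst_add_mul_snd_compProd_sub κ₁ κ₂ hφ hC
      (a := fun u => A₁ u ^ 2 - A₂ u ^ 2) ((hI₁.sub hI₂).const_mul (-2))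
      ((hI₁.aestronglyMeasurable.pow 2).sub (hI₂.aestronglyMeasurable.pow 2)) hF₁
    rw [← e₁, ← e₂] at h
    rw [hF]
    refine h.trans ?_
    rw [← integral_const_mul]
    refine integral_congr_ae ?_
    filter_upwards [hA₁, hA₂, hWint.prod_right_ae] with u h₁ h₂ hu
    have hi₁ : Integrable (fun v => W u v * ψ₁ v) unif01 :=
      hu.mul_bdd hψ₁.aestronglyMeasurable (Eventually.of_forall hC₁)
    have hi₂ : Integrable (fun v => W u v * ψ₂ v) unif01 :=
      hu.mul_bdd hψ₂.aestronglyMeasurable (Eventually.of_forall hC₂)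
    have hsplit : ∫ v, W u v * (ψ₁ u - ψ₂ u) * (ψ₁ v - ψ₂ v) ∂unif01
        = (ψ₁ u - ψ₂ u) * (A₁ u - A₂ u) := by
      rw [show A₁ u = ∫ v, W u v * ψ₁ v ∂unif01 from h₁,
        show A₂ u = ∫ v, W u v * ψ₂ v ∂unif01 from h₂, ← integral_sub hi₁ hi₂, ← integral_const_mul]
      congr 1 with v
      ring
    rw [hsplit]
    simp only [Pi.sub_apply]
    ring
  have hpsd := hWpsd (fun u => ψ₁ u - ψ₂ u) (hψ₁.sub hψ₂)
    ⟨C + C, fun u => (abs_sub _ _).trans (add_le_add (hC₁ u) (hC₂ u))⟩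
  refine ⟨?_, 2, two_pos, hEq⟩
  refine hEq.trans_le ?_
  linarith

end
end
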